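/- Let m ≥ 4. For every ψ ∈ Λ²₀₊, the operator A := -(1/(m(m+4)))·(-2·σ₃ψ + (m+2)·ϑψ) satisfies ρ(A) = 0 and ρ₁₃(A) = ψ. In particular, the map ψ ↦ A splits the contraction ρ₁₃ on the subspace of K₊ ∩ ker(ρ) mapping onto Λ²₀₊. -/

import Mathlib

open Module
open scoped RealInnerProductSpace

variable {V : Type*} [NormedAddCommGroup V] [InnerProductSpace ℝ V] [FiniteDimensional ℝ V]

/-- The Ricci tensor `ρ(A)(x,y) = Tr (z ↦ A(z,x)y)`. -/
noncomputable def rho (A : V →ₗ[ℝ] V →ₗ[ℝ] V →ₗ[ℝ] V) (x y : V) : ℝ :=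
  LinearMap.trace ℝ V ((A.flip x).flip y)

/-- for `ψ ∈ Λ²₀₊`, `A = -(1/(m(m+4)))(-2σ₃ψ + (m+2)ϑψ)` satisfies `ρ(A) = 0` and `ρ₁₃(A) = ψ`. -/
theorem statement16 {m : ℕ} (hm : 4 ≤ m) (e : OrthonormalBasis (Fin m) ℝ V)
    (J : V →ₗ[ℝ] V) (hJ : ∀ v, J (J v) = -v)
    (hJinner : ∀ x y : V, ⟪J x, J y⟫ = ⟪x, y⟫)
    (φ : V →ₗ[ℝ] V →ₗ[ℝ] ℝ) (hsym : ∀ x y, φ x y = - φ y x)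
    (hJφ : ∀ x y, φ (J x) (J y) = φ x y) (htr : ∑ i, φ (e i) (J (e i)) = 0)
    (S : V →ₗ[ℝ] V →ₗ[ℝ] V →ₗ[ℝ] V)
    (hS : ∀ x y z, S x y z = φ x z • y - φ y z • x + (2 * φ x y) • z - φ x (J z) • J y + φ y (J z) • J x)
    (T : V →ₗ[ℝ] V →ₗ[ℝ] V →ₗ[ℝ] V)
    (hT : ∀ x y z w : V, ⟪T x y z, w⟫ =
      φ x w * ⟪y, z⟫ - φ y w * ⟪x, z⟫ + φ x (J w) * ⟪y, J z⟫ - φ y (J w) * ⟪x, J z⟫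
        - 2 * φ z (J w) * ⟪x, J y⟫)
    (A : V →ₗ[ℝ] V →ₗ[ℝ] V →ₗ[ℝ] V)
    (hA : A = (-(1 / ((m : ℝ) * ((m : ℝ) + 4)))) • ((-2 : ℝ) • S + ((m : ℝ) + 2) • T)) :
    (∀ x y, rho A x y = 0) ∧ ∀ x y, (∑ i, ⟪A (e i) x (e i), y⟫) = φ x y := by
  have key : ∀ (f : V →ₗ[ℝ] ℝ) (v : V), ∑ i, f (e i) * ⟪e i, v⟫ = f v := by
    intro f v
    conv_rhs => rw [← e.sum_repr' v]
    simp [map_sum, mul_comm]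
  have hskew : ∀ x y : V, ⟪J x, y⟫ = -⟪x, J y⟫ := by
    intro x y
    have h := hJinner x (J y)
    rw [hJ, inner_neg_right] at h
    linarith
  have hself : ∀ x : V, ⟪x, J x⟫ = 0 := by
    intro x
    have h := hskew x x
    rw [real_inner_comm] at h
    linarith
  have hφself : ∀ x : V, φ x x = 0 := by
    intro x
    have h := hsym x x
    linarith
  have hone : ∀ i, ⟪e i, e i⟫ = (1 : ℝ) := fun i => by
    simp
  have k1 : ∀ u v : V, ∑ i, φ (e i) u * ⟪e i, v⟫ = φ v u := fun u v => key (φ.flip u) v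
  have k2 : ∀ u v : V, ∑ i, φ u (e i) * ⟪e i, v⟫ = φ u v := fun u v => key (φ u) v
  have k3 : ∀ u v : V, ∑ i, φ u (J (e i)) * ⟪e i, v⟫ = φ u (J v) :=
    fun u v => key ((φ u).comp J) v
  have hm0 : (m : ℝ) ≠ 0 := by
    have : m ≠ 0 := by omega
    exact_mod_cast this
  have hm4 : (m : ℝ) + 4 ≠ 0 := by positivity
  have rS : ∀ x y, ∑ i, ⟪e i, S (e i) x y⟫ = -((m : ℝ) + 2) * φ x y := by
    intro x y
    have : ∀ i, ⟪e i, S (e i) x y⟫ = φ (e i) y * ⟪e i, x⟫ - φ x y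
        + 2 * (φ (e i) x * ⟪e i, y⟫) - φ (e i) (J y) * ⟪e i, J x⟫ := by
      intro i
      rw [hS]
      simp only [inner_add_right, inner_sub_right, real_inner_smul_right, hself, hone]
      ring
    simp only [this, Finset.sum_add_distrib, Finset.sum_sub_distrib, ← Finset.mul_sum, k1]
    simp [hJφ]
    rw [hsym y x]
    ring
  have rT : ∀ x y, ∑ i, ⟪e i, T (e i) x y⟫ = -2 * φ x y := by
    intro x y
    have : ∀ i, ⟪e i, T (e i) x y⟫ = - (φ x (e i) * ⟪e i, y⟫)
        + φ (e i) (J (e i)) * ⟪x, J y⟫ - φ x (J (e i)) * ⟪e i, J y⟫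
        - 2 * (φ y (J (e i)) * ⟪e i, J x⟫) := by
      intro i
      rw [real_inner_comm, hT, hφself]
      ring
    simp only [this, Finset.sum_add_distrib, Finset.sum_sub_distrib, Finset.sum_neg_distrib,
      ← Finset.mul_sum, ← Finset.sum_mul, k2, k3, htr, hJ, map_neg]
    rw [hsym y x]
    ring
  have qS : ∀ x y, ∑ i, ⟪S (e i) x (e i), y⟫ = -2 * φ x y := by
    intro x y
    have : ∀ i, ⟪S (e i) x (e i), y⟫ = - (φ x (e i) * ⟪e i, y⟫)
        + 2 * (φ (e i) x * ⟪e i, y⟫) - φ (e i) (J (e i)) * ⟪J x, y⟫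
        - φ x (J (e i)) * ⟪e i, J y⟫ := by
      intro i
      rw [hS]
      simp only [inner_add_left, inner_sub_left, real_inner_smul_left, hφself, hskew (e i) y]
      ring
    simp only [this, Finset.sum_add_distrib, Finset.sum_sub_distrib, Finset.sum_neg_distrib,
      ← Finset.mul_sum, ← Finset.sum_mul, k1, k2, k3, htr, hJ, map_neg]
    rw [hsym y x]
    ring
  have qT : ∀ x y, ∑ i, ⟪T (e i) x (e i), y⟫ = -((m : ℝ) + 2) * φ x y := by
    intro x y
    have : ∀ i, ⟪T (e i) x (e i), y⟫ = φ (e i) y * ⟪e i, x⟫ - φ x y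
        - 3 * (φ (e i) (J y) * ⟪e i, J x⟫) := by
      intro i
      have h : ⟪x, J (e i)⟫ = -⟪e i, J x⟫ := by
        rw [real_inner_comm, hskew]
      rw [hT, hself, hone, h, real_inner_comm]
      ring
    simp only [this, Finset.sum_sub_distrib, ← Finset.mul_sum, k1]
    simp [hJφ]
    ring
  subst hA
  constructor
  · intro x y
    unfold rho
    rw [LinearMap.trace_eq_sum_inner _ e]
    simp only [LinearMap.flip_apply, LinearMap.smul_apply, LinearMap.add_apply, inner_add_right,
      real_inner_smul_right, ← Finset.mul_sum, Finset.sum_add_distrib, rS, rT]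
    ring
  · intro x y
    simp only [LinearMap.smul_apply, LinearMap.add_apply, inner_add_left,
      real_inner_smul_left, ← Finset.mul_sum, Finset.sum_add_distrib, qS, qT]
    field_simp
    ring
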